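/- For every Schwartz function φ on ℝ^4 × ℝ^4 × ℝ^4 the integral below is absolutely convergent and ∫_{ℝ^{12}} |x|^{−2} |y|^{−2} |z|^{−2} |x−y|^{−2} |y−z|^{−2} |x−z|^{−2} · [ (x·∇_x + y·∇_y + z·∇_z) φ ](x,y,z) dx dy dz = −12 π⁶ ζ(3) φ(0,0,0), where ζ is the Riemann zeta function. (This identity expresses the residue of the primitive tetrahedron graph of massless φ⁴ theory in four dimensions: the scale derivative of the renormalized tetrahedron amplitude is −12π⁶ ζ(3) δ.) -/

import Mathlib

open MeasureTheory Real SchwartzMap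

noncomputable section

/-- `ζ(3) = Σ_{n≥1} 1/n³`, the value of the Riemann zeta function at `3`. -/
def zeta3 : ℝ := ∑' n : ℕ, 1 / ((n : ℝ) + 1) ^ 3

lemma lint_abs (G : ℝ → ENNReal) (hG : Measurable G) :
    ∫⁻ t : ℝ, G |t| = 2 * ∫⁻ t in Set.Ioi (0:ℝ), G t := by
  rw [← lintegral_add_compl _ (measurableSet_Ioi (a := (0:ℝ)))]
  have h1 : ∫⁻ t in Set.Ioi (0:ℝ), G |t| = ∫⁻ t in Set.Ioi (0:ℝ), G t :=
    setLIntegral_congr_fun measurableSet_Ioi (fun t ht => by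
      rw [abs_of_pos (by exact ht)])
  have h2 : ∫⁻ t in (Set.Ioi (0:ℝ))ᶜ, G |t| = ∫⁻ t in Set.Ioi (0:ℝ), G t := by
    rw [Set.compl_Ioi, ← h1, ← setLIntegral_congr (Iio_ae_eq_Iic (a := (0:ℝ)))]
    have := (Measure.measurePreserving_neg (volume : Measure ℝ)).setLIntegral_comp_preimage
      (measurableSet_Ioi (a := (0:ℝ))) (f := fun t => G |t|) (by fun_prop)
    rw [← this]
    simp
  rw [h1, h2, two_mul]

lemma lint_exp_Ioi {k : ℝ} (hk : 0 < k) (c : ℝ) :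
    ∫⁻ u in Set.Ioi c, ENNReal.ofReal (exp (-k * u)) = ENNReal.ofReal (exp (-k*c) / k) := by
  rw [← ofReal_integral_eq_lintegral_ofReal (integrableOn_exp_mul_Ioi (by linarith) c)
    (Filter.Eventually.of_forall fun x => (exp_pos _).le), integral_exp_mul_Ioi (by linarith)]
  rw [neg_div_neg_eq]

lemma lint_exp_Iic {k : ℝ} (hk : 0 < k) (c : ℝ) :
    ∫⁻ u in Set.Iic c, ENNReal.ofReal (exp (k * u)) = ENNReal.ofReal (exp (k*c) / k) := by
  rw [← ofReal_integral_eq_lintegral_ofReal (integrableOn_exp_mul_Iic (by linarith) c)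
    (Filter.Eventually.of_forall fun x => (exp_pos _).le), integral_exp_mul_Iic (by linarith)]

lemma rad_inner_nonneg {N : ℝ} (hN : 0 < N) {t : ℝ} (ht : 0 ≤ t) :
    ∫⁻ u : ℝ, ENNReal.ofReal (exp (-N * (|u| + |t-u|)))
      = ENNReal.ofReal (exp (-N * t) * (t + 1/N)) := by
  rw [← lintegral_add_compl _ (measurableSet_Iic (a := (0:ℝ))), Set.compl_Iic,
    ← Set.Ioc_union_Ioi_eq_Ioi ht, lintegral_union measurableSet_Ioi
      (Set.disjoint_left.2 (fun x hx hx' => not_lt.2 hx.2 hx'))]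
  have h1 : ∫⁻ u in Set.Iic (0:ℝ), ENNReal.ofReal (exp (-N * (|u| + |t-u|)))
      = ENNReal.ofReal (exp (-N*t) * (1/(2*N))) := by
    rw [setLIntegral_congr_fun (g := fun u => ENNReal.ofReal (exp (-N*t)) *
      ENNReal.ofReal (exp ((2*N)*u))) measurableSet_Iic (fun u hu => by
        have hu : u ≤ 0 := hu
        simp only
        rw [abs_of_nonpos hu, abs_of_nonneg (by linarith), ← ENNReal.ofReal_mul (exp_pos _).le,
          ← Real.exp_add]
        congr 2; ring)]
    rw [lintegral_const_mul' _ _ ENNReal.ofReal_ne_top, lint_exp_Iic (by linarith),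
      ← ENNReal.ofReal_mul (exp_pos _).le]
    simp
  have h2 : ∫⁻ u in Set.Ioc 0 t, ENNReal.ofReal (exp (-N * (|u| + |t-u|)))
      = ENNReal.ofReal (exp (-N*t) * t) := by
    rw [setLIntegral_congr_fun (g := fun u => ENNReal.ofReal (exp (-N*t))) measurableSet_Ioc
      (fun u hu => by
        simp only
        rw [abs_of_nonneg hu.1.le, abs_of_nonneg (by linarith [hu.2])]
        congr 2; ring)]
    rw [setLIntegral_const, Real.volume_Ioc, ← ENNReal.ofReal_mul (exp_pos _).le, sub_zero]
  have h3 : ∫⁻ u in Set.Ioi t, ENNReal.ofReal (exp (-N * (|u| + |t-u|)))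
      = ENNReal.ofReal (exp (-N*t) * (1/(2*N))) := by
    rw [setLIntegral_congr_fun (g := fun u => ENNReal.ofReal (exp (N*t)) *
      ENNReal.ofReal (exp (-(2*N)*u))) measurableSet_Ioi (fun u hu => by
        have hu : t < u := hu
        simp only
        rw [abs_of_nonneg (by linarith), abs_of_nonpos (by linarith),
          ← ENNReal.ofReal_mul (exp_pos _).le, ← Real.exp_add]
        congr 2; ring)]
    rw [lintegral_const_mul' _ _ ENNReal.ofReal_ne_top, lint_exp_Ioi (by linarith),
      ← ENNReal.ofReal_mul (exp_pos _).le, ← mul_div_assoc, ← Real.exp_add]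
    congr 1
    rw [mul_one_div]; congr 2; ring
  rw [h1, h2, h3, ← ENNReal.ofReal_add (by positivity) (by positivity),
    ← ENNReal.ofReal_add (by positivity) (by positivity)]
  congr 1
  field_simp
  ring

lemma rad_inner {N : ℝ} (hN : 0 < N) (t : ℝ) :
    ∫⁻ u : ℝ, ENNReal.ofReal (exp (-N * (|u| + |t-u|)))
      = ENNReal.ofReal (exp (-N * |t|) * (|t| + 1/N)) := by
  rcases le_total 0 t with h | h
  · rw [rad_inner_nonneg hN h, abs_of_nonneg h]
  · rw [← lintegral_neg_eq_self, abs_of_nonpos h, ← rad_inner_nonneg hN (by linarith : 0 ≤ -t)]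
    congr 1; ext u
    rw [abs_neg, ← abs_neg (t - -u)]
    congr 5; ring_nf

lemma rad_outer {N : ℝ} (hN : 0 < N) :
    ∫⁻ t in Set.Ioi (0:ℝ), ENNReal.ofReal (exp (-(2*N) * t) * (t + 1/N))
      = ENNReal.ofReal (3/(4*N^2)) := by
  let g : ℝ → ℝ := fun t => -(exp (-(2*N)*t) * (t/(2*N) + 3/(4*N^2)))
  have hd : ∀ x ∈ Set.Ici (0:ℝ), HasDerivAt g (exp (-(2*N) * x) * (x + 1/N)) x := by
    intro x _
    have h1 : HasDerivAt (fun t : ℝ => exp (-(2*N)*t)) (exp (-(2*N)*x) * (-(2*N))) x := by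
      simpa using ((hasDerivAt_id x).const_mul (-(2*N))).exp
    have h2 : HasDerivAt (fun t : ℝ => t/(2*N) + 3/(4*N^2)) (1/(2*N)) x :=
      ((hasDerivAt_id x).div_const _).add_const _
    refine (h1.mul h2).neg.congr_deriv ?_
    field_simp
    ring
  have hn : ∀ x ∈ Set.Ioi (0:ℝ), 0 ≤ exp (-(2*N) * x) * (x + 1/N) := by
    intro x hx
    have hx : 0 < x := hx
    positivity
  have hl : Filter.Tendsto g Filter.atTop (nhds 0) := by
    have hlin : Filter.Tendsto (fun t : ℝ => (2*N)*t) Filter.atTop Filter.atTop :=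
      Filter.tendsto_id.const_mul_atTop (by linarith)
    have a1 := (Real.tendsto_pow_mul_exp_neg_atTop_nhds_zero 1).comp hlin
    have a0 := (Real.tendsto_pow_mul_exp_neg_atTop_nhds_zero 0).comp hlin
    have := ((a1.mul_const (1/(4*N^2))).add (a0.mul_const (3/(4*N^2)))).neg
    simp only [zero_mul, add_zero, neg_zero] at this
    refine this.congr (fun t => ?_)
    simp only [g, Function.comp]
    rw [neg_mul]
    field_simp
    ring
  rw [← ofReal_integral_eq_lintegral_ofReal (integrableOn_Ioi_deriv_of_nonneg' hd hn hl)
    (by filter_upwards [ae_restrict_mem measurableSet_Ioi] with x hx using hn x hx),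
    integral_Ioi_of_hasDerivAt_of_nonneg' hd hn hl]
  simp [g]

lemma radial {N : ℝ} (hN : 0 < N) :
    ∫⁻ t : ℝ, ∫⁻ u : ℝ, ENNReal.ofReal (exp (-N * (|t| + (|u| + |t-u|))))
      = ENNReal.ofReal (3/(2*N^2)) := by
  have h : ∀ t : ℝ, ∫⁻ u : ℝ, ENNReal.ofReal (exp (-N * (|t| + (|u| + |t-u|))))
      = ENNReal.ofReal (exp (-(2*N) * |t|) * (|t| + 1/N)) := by
    intro t
    have : ∀ u : ℝ, ENNReal.ofReal (exp (-N * (|t| + (|u| + |t-u|))))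
        = ENNReal.ofReal (exp (-N * |t|)) * ENNReal.ofReal (exp (-N * (|u| + |t-u|))) := by
      intro u
      rw [← ENNReal.ofReal_mul (exp_pos _).le, ← Real.exp_add, mul_add]
    simp_rw [this]
    rw [lintegral_const_mul' _ _ ENNReal.ofReal_ne_top, rad_inner hN,
      ← ENNReal.ofReal_mul (exp_pos _).le, ← mul_assoc, ← Real.exp_add]
    congr 3; ring
  simp_rw [h]
  rw [lint_abs (fun t => ENNReal.ofReal (exp (-(2*N) * t) * (t + 1/N))) (by fun_prop),
    rad_outer hN, show (2 : ENNReal) = ENNReal.ofReal 2 by simp, ← ENNReal.ofReal_mul (by norm_num)]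
  congr 1
  field_simp
  ring

lemma summable_zeta3 : Summable fun n : ℕ => 1 / ((n : ℝ) + 1) ^ 3 := by
  have := (summable_nat_add_iff 1).2 (Real.summable_one_div_nat_pow.2 (by norm_num : 1 < 3))
  simpa using this

lemma core_radial :
    ∫⁻ t : ℝ, ∫⁻ u : ℝ, ∑' n : ℕ, ENNReal.ofReal (π^2 / (n+1)
      * exp (-(n+1) * (|t| + (|u| + |t-u|)))) = ENNReal.ofReal (3/2 * π^2 * zeta3) := by
  have hm : ∀ n : ℕ, Measurable (fun p : ℝ × ℝ => ENNReal.ofReal (π^2 / (n+1)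
      * exp (-(n+1) * (|p.1| + (|p.2| + |p.1-p.2|))))) := by
    intro n; fun_prop
  have h1 : ∀ t : ℝ, ∫⁻ u : ℝ, ∑' n : ℕ, ENNReal.ofReal (π^2 / (n+1)
      * exp (-(n+1) * (|t| + (|u| + |t-u|)))) = ∑' n : ℕ, ∫⁻ u : ℝ, ENNReal.ofReal (π^2 / (n+1)
      * exp (-(n+1) * (|t| + (|u| + |t-u|)))) := by
    intro t
    rw [lintegral_tsum]
    intro n; fun_prop
  simp_rw [h1]
  rw [lintegral_tsum (fun n => (Measurable.lintegral_prod_right' (hm n)).aemeasurable)]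
  have h2 : ∀ n : ℕ, ∫⁻ t : ℝ, ∫⁻ u : ℝ, ENNReal.ofReal (π^2 / (n+1)
      * exp (-(n+1) * (|t| + (|u| + |t-u|))))
      = ENNReal.ofReal (3/2 * π^2 * (1 / ((n : ℝ) + 1) ^ 3)) := by
    intro n
    have hN : (0:ℝ) < n + 1 := by positivity
    have hp : 0 ≤ π^2 / ((n:ℝ)+1) := by positivity
    simp_rw [ENNReal.ofReal_mul hp]
    have h3 : ∀ t : ℝ, ∫⁻ u : ℝ, ENNReal.ofReal (π^2 / ((n:ℝ)+1)) *
        ENNReal.ofReal (exp (-((n:ℝ)+1) * (|t| + (|u| + |t-u|)))) =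
        ENNReal.ofReal (π^2 / ((n:ℝ)+1)) * ∫⁻ u : ℝ,
        ENNReal.ofReal (exp (-((n:ℝ)+1) * (|t| + (|u| + |t-u|)))) := fun t =>
      lintegral_const_mul' _ _ ENNReal.ofReal_ne_top
    simp_rw [h3]
    rw [lintegral_const_mul' _ _ ENNReal.ofReal_ne_top, radial hN, ← ENNReal.ofReal_mul hp]
    congr 1
    field_simp
  simp_rw [h2]
  rw [← ENNReal.ofReal_tsum_of_nonneg (fun n => by positivity) (summable_zeta3.mul_left _),
    tsum_mul_left, zeta3]

abbrev E4 := EuclideanSpace ℝ (Fin 4)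

lemma zon_split (G : (Fin 4 → ℝ) → ENNReal) (hG : Measurable G) :
    ∫⁻ w, G w = ∫⁻ x0 : ℝ, ∫⁻ x1 : ℝ, ∫⁻ p : ℝ × ℝ, G ![x0, x1, p.1, p.2] := by
  have h1 := (volume_preserving_piFinSuccAbove (fun _ : Fin 4 => ℝ) 0).symm
  have h2 := (volume_preserving_piFinSuccAbove (fun _ : Fin 3 => ℝ) 0).symm
  have h3 := (volume_preserving_finTwoArrow ℝ).symm
  rw [← h1.lintegral_comp hG]
  rw [Measure.volume_eq_prod, lintegral_prod _ (by fun_prop)]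
  congr 1; ext x0
  rw [← h2.lintegral_comp (by fun_prop)]
  rw [Measure.volume_eq_prod, lintegral_prod _ (by fun_prop)]
  congr 1; ext x1
  rw [← h3.lintegral_comp (by fun_prop)]
  congr 1; ext p
  congr 1; ext i
  fin_cases i <;> rfl

lemma radial2 (G : ℝ → ENNReal) (hG : Measurable G) :
    ∫⁻ p : ℝ × ℝ, G (p.1^2 + p.2^2) = ∫⁻ q in Set.Ioi (0:ℝ), ENNReal.ofReal (2*π*q) * G (q^2) := by
  rw [← lintegral_comp_polarCoord_symm]
  have : ∀ p : ℝ × ℝ, ENNReal.ofReal p.1 • G ((polarCoord.symm p).1^2 + (polarCoord.symm p).2^2)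
      = (ENNReal.ofReal p.1 * G (p.1^2)) * 1 := by
    intro p
    simp only [polarCoord_symm_apply, smul_eq_mul, mul_one]
    congr 2
    have := Real.sin_sq_add_cos_sq p.2
    linear_combination p.1^2 * this
  simp_rw [this]
  rw [polarCoord_target, Measure.volume_eq_prod, ← Measure.prod_restrict]
  rw [lintegral_prod _ (by fun_prop)]
  congr 1; ext q
  simp only [mul_one, lintegral_const, Measure.restrict_apply_univ, Real.volume_Ioo]
  rw [mul_right_comm, ← ENNReal.ofReal_mul' (by linarith [pi_pos])]
  congr 2; ring

lemma shift_rho (G : ℝ → ENNReal) (u : ℝ) (hu : u ≠ 0) :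
    ∫⁻ q in Set.Ioi (0:ℝ), ENNReal.ofReal (2*π*q) * G (u^2 + q^2)
      = ∫⁻ ρ in Set.Ioi |u|, ENNReal.ofReal (2*π*ρ) * G (ρ^2) := by
  have him : Set.image (fun q : ℝ => √(u^2+q^2)) (Set.Ioi 0) = Set.Ioi |u| := by
    ext ρ
    simp only [Set.mem_image, Set.mem_Ioi]
    constructor
    · rintro ⟨q, hq, rfl⟩
      rw [← Real.sqrt_sq_eq_abs]
      exact Real.sqrt_lt_sqrt (by positivity) (by nlinarith)
    · intro h
      have h0 : 0 ≤ |u| := abs_nonneg u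
      have h1 : u^2 < ρ^2 := by
        rw [← sq_abs u]; nlinarith
      refine ⟨√(ρ^2-u^2), Real.sqrt_pos.2 (by linarith), ?_⟩
      rw [Real.sq_sqrt (by linarith)]
      ring_nf
      exact Real.sqrt_sq (by linarith)
  have hpos : ∀ q : ℝ, 0 < u^2+q^2 := fun q => by positivity
  rw [← him, lintegral_image_eq_lintegral_abs_deriv_mul (f' := fun q => q / √(u^2+q^2))
    measurableSet_Ioi]
  · refine setLIntegral_congr_fun measurableSet_Ioi ?_
    intro q hq
    have hq : 0 < q := hq
    have := Real.sqrt_pos.2 (hpos q)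
    simp only
    rw [Real.sq_sqrt (hpos q).le, ← mul_assoc, ← ENNReal.ofReal_mul (abs_nonneg _),
      abs_of_nonneg (by positivity)]
    congr 2
    field_simp
  · intro q hq
    have h := (((hasDerivAt_id q).pow 2).const_add (u^2)).sqrt (hpos q).ne'
    refine (h.congr_deriv ?_).hasDerivWithinAt
    simp
    field_simp
  · intro x hx y hy h
    simp only at h
    have hx : 0 < x := hx
    have hy : 0 < y := hy
    rw [Real.sqrt_inj (hpos x).le (hpos y).le] at h
    nlinarith

lemma swap_rho (H : ℝ × ℝ → ENNReal) (hH : Measurable H) :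
    ∫⁻ u : ℝ, ∫⁻ ρ in Set.Ioi |u|, H (u, ρ)
      = ∫⁻ ρ in Set.Ioi (0:ℝ), ∫⁻ u in Set.Ioo (-ρ) ρ, H (u, ρ) := by
  have hm : MeasurableSet {p : ℝ × ℝ | |p.1| < p.2} :=
    measurableSet_lt (by fun_prop) (by fun_prop)
  have h1 : ∀ u : ℝ, ∫⁻ ρ in Set.Ioi |u|, H (u, ρ)
      = ∫⁻ ρ, ({p : ℝ × ℝ | |p.1| < p.2}.indicator H) (u, ρ) := by
    intro u
    rw [← lintegral_indicator measurableSet_Ioi]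
    rfl
  simp_rw [h1]
  rw [lintegral_lintegral_swap (by exact (hH.indicator hm).aemeasurable)]
  rw [← lintegral_indicator measurableSet_Ioi]
  congr 1; ext ρ
  by_cases hρ : 0 < ρ
  · rw [Set.indicator_of_mem (by exact hρ), ← lintegral_indicator measurableSet_Ioo]
    congr 1; ext u
    simp only [Set.indicator, Set.mem_ofPred_eq, Set.mem_Ioo, abs_lt]
  · rw [Set.indicator_of_notMem (by exact hρ)]
    simp only [Set.indicator, Set.mem_ofPred_eq]
    have : ∀ u : ℝ, ¬ |u| < ρ := fun u h => hρ ((abs_nonneg u).trans_lt h)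
    simp [this]

lemma lintegral_exp_sub (G : ℝ → ENNReal) :
    ∫⁻ r in Set.Ioi (0:ℝ), G r = ∫⁻ t : ℝ, ENNReal.ofReal (exp t) * G (exp t) := by
  have h := lintegral_image_eq_lintegral_abs_deriv_mul (f := Real.exp) (f' := Real.exp)
    MeasurableSet.univ (fun x _ => (Real.hasDerivAt_exp x).hasDerivWithinAt)
    Real.exp_injective.injOn G
  rw [Set.image_univ, Real.range_exp] at h
  rw [h]
  simp [abs_of_pos (Real.exp_pos _)]

lemma half_polar (H : ℝ × ℝ → ENNReal) (hH : Measurable H) :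
    ∫⁻ x : ℝ, ∫⁻ ρ in Set.Ioi (0:ℝ), H (x, ρ)
      = ∫⁻ t : ℝ, ∫⁻ α in Set.Ioo 0 π,
          ENNReal.ofReal (exp (2*t)) * H (exp t * cos α, exp t * sin α) := by
  have hm : MeasurableSet {p : ℝ × ℝ | 0 < p.2} :=
    measurableSet_lt (by fun_prop) (by fun_prop)
  have h1 : ∀ u : ℝ, ∫⁻ ρ in Set.Ioi (0:ℝ), H (u, ρ)
      = ∫⁻ ρ, ({p : ℝ × ℝ | 0 < p.2}.indicator H) (u, ρ) := by
    intro u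
    rw [← lintegral_indicator measurableSet_Ioi]
    rfl
  simp_rw [h1]
  have hHi := hH.indicator hm
  rw [lintegral_lintegral (by exact hHi.aemeasurable)]
  rw [← Measure.volume_eq_prod, ← lintegral_comp_polarCoord_symm]
  rw [polarCoord_target, Measure.volume_eq_prod, ← Measure.prod_restrict]
  have hc : Measurable (polarCoord.symm : ℝ × ℝ → ℝ × ℝ) := continuous_polarCoord_symm.measurable
  rw [lintegral_prod _ (by
    refine Measurable.aemeasurable ?_
    simp only [smul_eq_mul]
    exact Measurable.mul (by fun_prop) (hHi.comp hc))]
  rw [lintegral_exp_sub]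
  congr 1; ext t
  rw [← lintegral_const_mul' _ _ ENNReal.ofReal_ne_top]
  have hsub : Set.Ioo 0 π ⊆ Set.Ioo (-π) π := Set.Ioo_subset_Ioo_left (by linarith [pi_pos])
  rw [← Set.inter_eq_self_of_subset_left hsub, ← Measure.restrict_restrict measurableSet_Ioo]
  rw [← lintegral_indicator (μ := volume.restrict (Set.Ioo (-π) π)) measurableSet_Ioo]
  refine setLIntegral_congr_fun measurableSet_Ioo ?_
  intro α hα
  simp only [polarCoord_symm_apply, smul_eq_mul]
  by_cases h : 0 < α
  · have hs : 0 < sin α := sin_pos_of_pos_of_lt_pi h hα.2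
    rw [Set.indicator_of_mem (by exact mul_pos (exp_pos t) hs), Set.indicator_of_mem (s := Set.Ioo 0 π) ⟨h, hα.2⟩]
    rw [← mul_assoc, ← ENNReal.ofReal_mul (exp_pos t).le, ← Real.exp_add, two_mul]
  · have hs : sin α ≤ 0 := sin_nonpos_of_nonpos_of_neg_pi_le (not_lt.1 h) hα.1.le
    rw [Set.indicator_of_notMem, Set.indicator_of_notMem]
    · simp
    · exact fun h' => h h'.1
    · simp only [Set.mem_ofPred_eq, not_lt]
      exact mul_nonpos_of_nonneg_of_nonpos (exp_pos t).le hs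

theorem zonal (a b : E4) (ha : ‖a‖ = 1) (hb : ‖b‖ = 1) (hab : inner ℝ a b = 0)
    (F : ℝ × ℝ × ℝ → ENNReal) (hF : Measurable F) :
    ∫⁻ z : E4, F (inner ℝ a z, inner ℝ b z, ‖z‖^2)
      = ∫⁻ t : ℝ, ∫⁻ α in Set.Ioo 0 π, ENNReal.ofReal (2*π*exp (3*t) * sin α) *
          ∫⁻ u in Set.Ioo (-(exp t * sin α)) (exp t * sin α),
            F (exp t * cos α, u, exp (2*t)) := by
  obtain ⟨v, hv⟩ : ∃ v : OrthonormalBasis (Fin 4) ℝ E4, v 0 = a ∧ v 1 = b := by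
    have hba : inner ℝ b a = 0 := by rw [real_inner_comm]; exact hab
    obtain ⟨v, hv⟩ := Orthonormal.exists_orthonormalBasis_extension_of_card_eq
      (𝕜 := ℝ) (E := E4) (ι := Fin 4) (by simp) (v := ![a, b, 0, 0]) (s := {0, 1}) (by
        rw [orthonormal_iff_ite]
        rintro ⟨i, hi⟩ ⟨j, hj⟩
        rcases hi with rfl | rfl <;> rcases hj with rfl | rfl <;>
          simp [ha, hb, hab, hba, Subtype.ext_iff])
    exact ⟨v, by simpa using hv 0 (by simp), by simpa using hv 1 (by simp)⟩
  have hmp := (PiLp.volume_preserving_ofLp (Fin 4)).comp v.measurePreserving_repr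
  let G : (Fin 4 → ℝ) → ENNReal := fun w => F (w 0, w 1, w 0^2+w 1^2+(w 2^2+w 3^2))
  have hG : Measurable G := by fun_prop
  have e1 : ∫⁻ z : E4, F (inner ℝ a z, inner ℝ b z, ‖z‖^2) = ∫⁻ w, G w := by
    rw [← hmp.lintegral_comp hG]
    congr 1; ext z
    simp only [G, Function.comp]
    rw [← v.repr.norm_map z, EuclideanSpace.norm_sq_eq, Fin.sum_univ_four]
    simp only [← hv.1, ← hv.2, ← v.repr_apply_apply, Real.norm_eq_abs, sq_abs]
    congr 3
    ring
  rw [e1, zon_split G hG]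
  have e2 : ∀ x0 : ℝ, ∫⁻ x1 : ℝ, ∫⁻ p : ℝ × ℝ, G ![x0, x1, p.1, p.2]
      = ∫⁻ ρ in Set.Ioi (0:ℝ), ∫⁻ u in Set.Ioo (-ρ) ρ,
        ENNReal.ofReal (2*π*ρ) * F (x0, u, x0^2+ρ^2) := by
    intro x0
    rw [← swap_rho (fun q => ENNReal.ofReal (2*π*q.2) * F (x0, q.1, x0^2+q.2^2)) (by fun_prop)]
    refine lintegral_congr_ae ?_
    have : ∀ᵐ x : ℝ, x ≠ 0 := by simp [ae_iff]
    filter_upwards [this] with x1 hx1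
    rw [← shift_rho (fun w => F (x0, x1, x0^2+w)) x1 hx1]
    rw [← radial2 (fun w => F (x0, x1, x0^2+(x1^2+w))) (by fun_prop)]
    simp [G, add_assoc]
  simp_rw [e2]
  have hm : Measurable (fun p : ℝ × ℝ => ∫⁻ u in Set.Ioo (-p.2) p.2,
        ENNReal.ofReal (2*π*p.2) * F (p.1, u, p.1^2+p.2^2)) := by
    have hs : MeasurableSet {q : (ℝ × ℝ) × ℝ | -q.1.2 < q.2 ∧ q.2 < q.1.2} :=
      MeasurableSet.inter (s₁ := {q : (ℝ × ℝ) × ℝ | -q.1.2 < q.2})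
        (s₂ := {q : (ℝ × ℝ) × ℝ | q.2 < q.1.2})
        (measurableSet_lt (by fun_prop) (by fun_prop))
        (measurableSet_lt (by fun_prop) (by fun_prop))
    have : ∀ p : ℝ × ℝ, ∫⁻ u in Set.Ioo (-p.2) p.2,
        ENNReal.ofReal (2*π*p.2) * F (p.1, u, p.1^2+p.2^2)
        = ∫⁻ u, ({q : (ℝ × ℝ) × ℝ | -q.1.2 < q.2 ∧ q.2 < q.1.2}.indicator
          (fun q => ENNReal.ofReal (2*π*q.1.2) * F (q.1.1, q.2, q.1.1^2+q.1.2^2))) (p, u) := by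
      intro p
      rw [← lintegral_indicator measurableSet_Ioo]
      rfl
    simp_rw [this]
    exact Measurable.lintegral_prod_right' (Measurable.indicator (by fun_prop) hs)
  rw [half_polar _ hm]
  congr 1; ext t
  congr 1; ext α
  simp only
  rw [lintegral_const_mul' _ _ ENNReal.ofReal_ne_top, ← mul_assoc,
    ← ENNReal.ofReal_mul (exp_pos _).le]
  have e3 : (exp t * cos α)^2 + (exp t * sin α)^2 = exp (2*t) := by
    have := Real.sin_sq_add_cos_sq α
    rw [two_mul, Real.exp_add]
    linear_combination exp t^2 * this
  rw [e3]
  congr 2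
  rw [show 3*t = 2*t+t by ring, Real.exp_add]
  ring

def Sk (t α : ℝ) : ℝ := sin α / (2 * (cosh t - cos α))
def Lk (t α γ : ℝ) : ℝ := log ((cosh t - cos (α + γ)) / (cosh t - cos (α - γ)))

lemma cosh_sub_cos_pos {t : ℝ} (ht : t ≠ 0) (θ : ℝ) : 0 < cosh t - cos θ := by
  have := Real.one_lt_cosh.2 ht
  linarith [Real.cos_le_one θ]

lemma exp_abs_cosh (t : ℝ) : 1 + exp (-|t|)^2 = 2 * exp (-|t|) * cosh t := by
  rw [← Real.cosh_abs t, Real.cosh_eq, pow_two]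
  have : exp (-|t|) * exp |t| = 1 := by rw [← Real.exp_add]; simp
  linear_combination -this

lemma exp_abs_lt {t : ℝ} (ht : t ≠ 0) : exp (-|t|) < 1 := by
  simpa using ht

lemma zpow_form (a θ : ℝ) (n : ℕ) :
    ((a : ℂ) * Complex.exp (θ * Complex.I))^n
      = ((a^n * cos (n * θ) : ℝ) : ℂ) + ((a^n * sin (n*θ) : ℝ) : ℂ) * Complex.I := by
  rw [mul_pow, ← Complex.exp_nat_mul, ← mul_assoc, Complex.exp_mul_I]
  push_cast
  ring

lemma zpow_re (a θ : ℝ) (n : ℕ) :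
    (((a : ℂ) * Complex.exp (θ * Complex.I))^n).re = a^n * cos (n * θ) := by
  rw [zpow_form, Complex.add_re, Complex.ofReal_re, Complex.re_ofReal_mul, Complex.I_re]
  ring

lemma zpow_im (a θ : ℝ) (n : ℕ) :
    (((a : ℂ) * Complex.exp (θ * Complex.I))^n).im = a^n * sin (n * θ) := by
  rw [zpow_form, Complex.add_im, Complex.ofReal_im, Complex.im_ofReal_mul, Complex.I_im]
  ring

lemma z_re (a θ : ℝ) : ((a : ℂ) * Complex.exp (θ * Complex.I)).re = a * cos θ := by
  have := zpow_re a θ 1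
  simpa only [pow_one, Nat.cast_one, one_mul] using this

lemma z_im (a θ : ℝ) : ((a : ℂ) * Complex.exp (θ * Complex.I)).im = a * sin θ := by
  have := zpow_im a θ 1
  simpa only [pow_one, Nat.cast_one, one_mul] using this

lemma normSq_form (a θ : ℝ) :
    Complex.normSq (1 - (a : ℂ) * Complex.exp (θ * Complex.I)) = 1 + a^2 - 2 * a * cos θ := by
  rw [Complex.normSq_apply, Complex.sub_re, Complex.sub_im, z_re, z_im, Complex.one_re,
    Complex.one_im]
  linear_combination a^2 * Real.sin_sq_add_cos_sq θ

lemma norm_form (a θ : ℝ) (ha : 0 ≤ a) : ‖(a : ℂ) * Complex.exp (θ * Complex.I)‖ = a := by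
  rw [norm_mul, Complex.norm_exp_ofReal_mul_I, mul_one]; simp [abs_of_nonneg ha]

lemma hasSum_Sk {t : ℝ} (ht : t ≠ 0) (α : ℝ) :
    HasSum (fun n : ℕ => exp (-|t|)^(n+1) * sin (((n+1 : ℕ) : ℝ) * α)) (Sk t α) := by
  set a := exp (-|t|) with ha
  have ha0 : 0 < a := exp_pos _
  have ha1 : a < 1 := exp_abs_lt ht
  set z : ℂ := (a : ℂ) * Complex.exp (α * Complex.I) with hz
  have hzn : ‖z‖ < 1 := by rw [hz, norm_form a α ha0.le]; exact ha1
  have h1 := Complex.hasSum_im ((hasSum_geometric_of_norm_lt_one hzn).mul_left z)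
  convert h1 using 1
  · ext n
    rw [← pow_succ', hz, zpow_im]
  · have hn : Complex.normSq (1 - z) = 2 * a * (cosh t - cos α) := by
      rw [hz, normSq_form, ha, exp_abs_cosh]; ring
    have hp := cosh_sub_cos_pos ht α
    rw [Complex.mul_im, Complex.inv_re, Complex.inv_im, hn]
    have hre : z.re = a * cos α := z_re a α
    have him : z.im = a * sin α := z_im a α
    simp only [Complex.sub_re, Complex.sub_im, Complex.one_re, Complex.one_im, hre, him, Sk]
    field_simp
    ring

lemma hasSum_logcos {t : ℝ} (ht : t ≠ 0) (θ : ℝ) :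
    HasSum (fun n : ℕ => exp (-|t|)^(n+1) * cos (((n+1 : ℕ) : ℝ) * θ) / (n+1))
      (- (1/2) * (log (2 * exp (-|t|)) + log (cosh t - cos θ))) := by
  set a := exp (-|t|) with ha
  have ha0 : 0 < a := exp_pos _
  have ha1 : a < 1 := exp_abs_lt ht
  set z : ℂ := (a : ℂ) * Complex.exp (θ * Complex.I) with hz
  have hzn : ‖z‖ < 1 := by rw [hz, norm_form a θ ha0.le]; exact ha1
  have h1 := Complex.hasSum_re (Complex.hasSum_taylorSeries_neg_log' hzn)
  convert h1 using 1
  · ext n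
    have : ((n:ℂ)+1) = (((n:ℝ)+1 : ℝ) : ℂ) := by push_cast; rfl
    rw [this, Complex.div_ofReal_re, hz, zpow_re]
  · have hn : Complex.normSq (1 - z) = 2 * a * (cosh t - cos θ) := by
      rw [hz, normSq_form, ha, exp_abs_cosh]; ring
    have hp := cosh_sub_cos_pos ht θ
    rw [Complex.neg_re, Complex.log_re, Complex.norm_def, hn, Real.log_sqrt (by positivity),
      Real.log_mul (by positivity) hp.ne']
    ring

lemma hasSum_Lk {t : ℝ} (ht : t ≠ 0) (α γ : ℝ) :
    HasSum (fun n : ℕ => 4 * exp (-|t|)^(n+1) / (n+1) * sin (((n+1 : ℕ) : ℝ) * α)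
      * sin (((n+1 : ℕ) : ℝ) * γ)) (Lk t α γ) := by
  have h := ((hasSum_logcos ht (α - γ)).sub (hasSum_logcos ht (α + γ))).mul_left 2
  have e1 : (fun n : ℕ => 4 * exp (-|t|)^(n+1) / (n+1) * sin (((n+1 : ℕ) : ℝ) * α)
      * sin (((n+1 : ℕ) : ℝ) * γ)) = fun n : ℕ =>
        2 * (exp (-|t|)^(n+1) * cos (((n+1 : ℕ) : ℝ) * (α - γ)) / (n+1) -
          exp (-|t|)^(n+1) * cos (((n+1 : ℕ) : ℝ) * (α + γ)) / (n+1)) := by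
    ext n
    rw [mul_sub (((n+1 : ℕ) : ℝ)), mul_add, Real.cos_sub, Real.cos_add]
    ring
  have e2 : Lk t α γ = 2 * (- (1/2) * (log (2 * exp (-|t|)) + log (cosh t - cos (α - γ)))
      - (- (1/2) * (log (2 * exp (-|t|)) + log (cosh t - cos (α + γ))))) := by
    rw [Lk, Real.log_div (cosh_sub_cos_pos ht _).ne' (cosh_sub_cos_pos ht _).ne']
    ring
  rw [e1, e2]
  exact h

lemma sin_orth (m n : ℕ) : ∫ α in (0:ℝ)..π, sin (((m+1 : ℕ) : ℝ) * α) * sin (((n+1 : ℕ) : ℝ) * α)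
    = if m = n then π/2 else 0 := by
  have key : ∀ k : ℤ, k ≠ 0 → ∫ α in (0:ℝ)..π, cos ((k:ℝ) * α) = 0 := by
    intro k hk
    have hk' : (k:ℝ) ≠ 0 := by exact_mod_cast hk
    rw [intervalIntegral.integral_comp_mul_left (fun x => cos x) hk', integral_cos]
    simp [Real.sin_int_mul_pi]
  have e : ∀ α : ℝ, sin (((m+1 : ℕ) : ℝ) * α) * sin (((n+1 : ℕ) : ℝ) * α)
      = (1/2) * (cos ((((m:ℤ) - n : ℤ) : ℝ) * α) - cos ((((m:ℤ) + n + 2 : ℤ) : ℝ) * α)) := by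
    intro α
    have h1 : (((m:ℤ) - n : ℤ) : ℝ) * α = ((m+1 : ℕ) : ℝ) * α - ((n+1 : ℕ) : ℝ) * α := by
      push_cast; ring
    have h2 : (((m:ℤ) + n + 2 : ℤ) : ℝ) * α = ((m+1 : ℕ) : ℝ) * α + ((n+1 : ℕ) : ℝ) * α := by
      push_cast; ring
    rw [h1, h2, Real.cos_sub, Real.cos_add]
    ring
  simp_rw [e]
  rw [intervalIntegral.integral_const_mul, intervalIntegral.integral_sub
    (Continuous.intervalIntegrable (by fun_prop) _ _)
    (Continuous.intervalIntegrable (by fun_prop) _ _), key ((m:ℤ) + n + 2) (by omega)]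
  split_ifs with h
  · subst h; simp; ring
  · rw [key _ (by omega)]; simp

lemma sine_cont {c : ℕ → ℝ} (hc : Summable fun n => |c n|) {f : ℝ → ℝ}
    (hf : ∀ α, HasSum (fun n : ℕ => c n * sin (((n+1 : ℕ) : ℝ) * α)) (f α)) : Continuous f := by
  have : f = fun α => ∑' n : ℕ, c n * sin (((n+1 : ℕ) : ℝ) * α) := by
    ext α; exact (hf α).tsum_eq.symm
  rw [this]
  refine continuous_tsum (fun n => by fun_prop) hc ?_
  intro n x
  rw [norm_mul]
  exact mul_le_of_le_one_right (norm_nonneg _) (Real.abs_sin_le_one _)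

lemma sine_int {c : ℕ → ℝ} (hc : Summable fun n => |c n|) {f : ℝ → ℝ}
    (hf : ∀ α, HasSum (fun n : ℕ => c n * sin (((n+1 : ℕ) : ℝ) * α)) (f α))
    {g : ℝ → ℝ} (hg : Continuous g) :
    HasSum (fun n : ℕ => c n * ∫ α in (0:ℝ)..π, sin (((n+1 : ℕ) : ℝ) * α) * g α)
      (∫ α in (0:ℝ)..π, f α * g α) := by
  obtain ⟨C, hC⟩ := (isCompact_uIcc (a := (0:ℝ)) (b := π)).exists_bound_of_continuousOn
    hg.continuousOn
  have h := intervalIntegral.hasSum_integral_of_dominated_convergence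
    (μ := volume) (a := 0) (b := π)
    (F := fun (n : ℕ) α => c n * (sin (((n+1 : ℕ) : ℝ) * α) * g α)) (f := fun α => f α * g α)
    (bound := fun n _ => |c n| * C)
    (fun n => Continuous.aestronglyMeasurable (by fun_prop))
    (fun n => Filter.Eventually.of_forall fun x hx => by
      rw [norm_mul, norm_mul]
      have h1 : ‖sin (((n+1 : ℕ) : ℝ) * x)‖ ≤ 1 := Real.abs_sin_le_one _
      have h2 := hC x (Set.uIoc_subset_uIcc hx)
      have h3 : ‖sin (((n+1 : ℕ) : ℝ) * x)‖ * ‖g x‖ ≤ 1 * C :=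
        mul_le_mul h1 h2 (norm_nonneg _) (by norm_num)
      rw [one_mul] at h3
      exact mul_le_mul_of_nonneg_left h3 (norm_nonneg _))
    (Filter.Eventually.of_forall fun x hx => hc.mul_right C)
    (by simp)
    (Filter.Eventually.of_forall fun x hx => by
      simpa [mul_assoc] using (hf x).mul_right (g x))
  have e : ∀ n : ℕ, ∫ α in (0:ℝ)..π, c n * (sin (((n+1 : ℕ) : ℝ) * α) * g α)
      = c n * ∫ α in (0:ℝ)..π, sin (((n+1 : ℕ) : ℝ) * α) * g α :=
    fun n => intervalIntegral.integral_const_mul _ _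
  simp_rw [e] at h
  exact h

lemma parseval {c d : ℕ → ℝ} (hc : Summable fun n => |c n|) (hd : Summable fun n => |d n|)
    {f g : ℝ → ℝ}
    (hf : ∀ α, HasSum (fun n : ℕ => c n * sin (((n+1 : ℕ) : ℝ) * α)) (f α))
    (hg : ∀ α, HasSum (fun n : ℕ => d n * sin (((n+1 : ℕ) : ℝ) * α)) (g α)) :
    HasSum (fun n => π/2 * (c n * d n)) (∫ α in (0:ℝ)..π, f α * g α) := by
  have h1 := sine_int hc hf (sine_cont hd hg)
  convert h1 using 2 with n
  have h2 := sine_int hd hg (g := fun α => sin (((n+1 : ℕ) : ℝ) * α)) (by fun_prop)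
  have h3 : ∫ α in (0:ℝ)..π, sin (((n+1 : ℕ) : ℝ) * α) * g α = d n * (π/2) := by
    simp_rw [sin_orth] at h2
    have h4 := hasSum_single (f := fun m => d m * if m = n then π/2 else 0) n
      (fun m hm => by simp [hm])
    rw [if_pos rfl] at h4
    rw [h4.unique h2]
    congr 1; ext; ring
  rw [h3]; ring

lemma parseval_lint {c d : ℕ → ℝ} (hc : Summable fun n => |c n|) (hd : Summable fun n => |d n|)
    {f g : ℝ → ℝ}
    (hf : ∀ α, HasSum (fun n : ℕ => c n * sin (((n+1 : ℕ) : ℝ) * α)) (f α))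
    (hg : ∀ α, HasSum (fun n : ℕ => d n * sin (((n+1 : ℕ) : ℝ) * α)) (g α))
    (hf0 : ∀ α ∈ Set.Ioo 0 π, 0 ≤ f α) (hg0 : ∀ α ∈ Set.Ioo 0 π, 0 ≤ g α) :
    ∫⁻ α in Set.Ioo 0 π, ENNReal.ofReal (f α * g α)
      = ENNReal.ofReal (∑' n, π/2 * (c n * d n)) := by
  rw [(parseval hc hd hf hg).tsum_eq, intervalIntegral.integral_of_le pi_pos.le,
    integral_Ioc_eq_integral_Ioo, ofReal_integral_eq_lintegral_ofReal]
  · exact (((sine_cont hc hf).mul (sine_cont hd hg)).integrableOn_Icc (a := 0) (b := π)).mono_set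
      Set.Ioo_subset_Icc_self
  · filter_upwards [ae_restrict_mem measurableSet_Ioo] with α hα
    exact mul_nonneg (hf0 α hα) (hg0 α hα)

lemma Sk_nonneg {t : ℝ} (ht : t ≠ 0) {α : ℝ} (hα : α ∈ Set.Ioo 0 π) : 0 ≤ Sk t α :=
  div_nonneg (sin_pos_of_pos_of_lt_pi hα.1 hα.2).le (by linarith [cosh_sub_cos_pos ht α])

lemma Lk_nonneg {t : ℝ} (ht : t ≠ 0) {α γ : ℝ} (hα : α ∈ Set.Ioo 0 π) (hγ : γ ∈ Set.Ioo 0 π) :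
    0 ≤ Lk t α γ := by
  apply Real.log_nonneg
  rw [one_le_div (cosh_sub_cos_pos ht _), Real.cos_add, Real.cos_sub]
  have := mul_pos (sin_pos_of_pos_of_lt_pi hα.1 hα.2) (sin_pos_of_pos_of_lt_pi hγ.1 hγ.2)
  linarith

lemma geo_summable {a : ℝ} (h0 : 0 ≤ a) (h1 : a < 1) : Summable fun n : ℕ => |a^(n+1)| := by
  have : Summable fun n : ℕ => a^(n+1) := by
    simpa [pow_succ] using (summable_geometric_of_lt_one h0 h1).mul_right a
  simpa [abs_of_nonneg h0] using this

lemma angular {t u : ℝ} (ht : t ≠ 0) (hu : u ≠ 0) (htu : t - u ≠ 0) :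
    ∫⁻ α in Set.Ioo 0 π, ENNReal.ofReal (Sk t α) *
      ∫⁻ γ in Set.Ioo 0 π, ENNReal.ofReal (Sk u γ * Lk (t-u) α γ)
    = ∑' n : ℕ, ENNReal.ofReal (π^2 / (n+1) * exp (-(n+1) * (|t| + (|u| + |t-u|)))) := by
  set a := exp (-|t|) with ha
  set b := exp (-|t-u|) with hb
  set c := exp (-|u|) with hc
  have ha0 : 0 < a := exp_pos _
  have hb0 : 0 < b := exp_pos _
  have hc0 : 0 < c := exp_pos _
  have ha1 : a < 1 := exp_abs_lt ht
  have hb1 : b < 1 := exp_abs_lt htu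
  have hc1 : c < 1 := exp_abs_lt hu
  have hbd : ∀ n : ℕ, (1:ℝ) ≤ n + 1 := fun n => by linarith [(Nat.cast_nonneg n : (0:ℝ) ≤ n)]
  have hcb1 : c * b < 1 := by nlinarith
  have hd1 : Summable fun n : ℕ => |π/2 * (c^(n+1) * (4 * b^(n+1)/(n+1)))| := by
    refine Summable.of_nonneg_of_le (fun n => abs_nonneg _) (fun n => ?_)
      ((geo_summable (mul_pos hc0 hb0).le hcb1).mul_left (2*π))
    rw [abs_of_nonneg (by have := hbd n; positivity), abs_of_nonneg (by positivity), mul_pow]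
    have : π/2 * (c^(n+1) * (4 * b^(n+1)/(n+1))) = 2*π*(c^(n+1)*b^(n+1)) / (n+1) := by ring
    rw [this]
    exact div_le_self (by positivity) (hbd n)
  have inner : ∀ α ∈ Set.Ioo 0 π,
      ∫⁻ γ in Set.Ioo 0 π, ENNReal.ofReal (Sk u γ * Lk (t-u) α γ)
      = ENNReal.ofReal (∑' n : ℕ, π/2 * (c^(n+1) * (4 * b^(n+1)/(n+1)))
          * sin (((n+1 : ℕ) : ℝ) * α)) := by
    intro α hα
    rw [parseval_lint (c := fun n => c^(n+1))
      (d := fun n => 4 * b^(n+1)/(n+1) * sin (((n+1 : ℕ) : ℝ) * α))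
      (geo_summable hc0.le hc1) ?_ (fun γ => hasSum_Sk hu γ) (fun γ => hasSum_Lk htu α γ)
      (fun γ hγ => Sk_nonneg hu hγ) (fun γ hγ => Lk_nonneg htu hα hγ)]
    · congr 2; ext n; ring
    · refine Summable.of_nonneg_of_le (fun n => abs_nonneg _) (fun n => ?_)
        ((geo_summable hb0.le hb1).mul_left 4)
      rw [abs_mul, abs_of_nonneg (by have := hbd n; positivity : 0 ≤ 4 * b^(n+1)/((n:ℝ)+1)),
        abs_of_nonneg (by positivity : 0 ≤ b^(n+1))]
      calc _ ≤ 4 * b^(n+1)/((n:ℝ)+1) :=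
            mul_le_of_le_one_right (by have := hbd n; positivity) (Real.abs_sin_le_one _)
        _ ≤ _ := div_le_self (by positivity) (hbd n)
  have hss : ∀ α, Summable fun n : ℕ => π/2 * (c^(n+1) * (4 * b^(n+1)/(n+1)))
          * sin (((n+1 : ℕ) : ℝ) * α) := by
    intro α
    refine Summable.of_norm_bounded hd1 (fun n => ?_)
    rw [norm_mul]
    exact mul_le_of_le_one_right (norm_nonneg _) (Real.abs_sin_le_one _)
  have hnn : ∀ α ∈ Set.Ioo 0 π, 0 ≤ ∑' n : ℕ, π/2 * (c^(n+1) * (4 * b^(n+1)/(n+1)))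
          * sin (((n+1 : ℕ) : ℝ) * α) := by
    intro α hα
    have h := parseval (c := fun n => c^(n+1))
      (d := fun n => 4 * b^(n+1)/(n+1) * sin (((n+1 : ℕ) : ℝ) * α))
      (geo_summable hc0.le hc1) (by
        refine Summable.of_nonneg_of_le (fun n => abs_nonneg _) (fun n => ?_)
          ((geo_summable hb0.le hb1).mul_left 4)
        rw [abs_mul, abs_of_nonneg (by have := hbd n; positivity : 0 ≤ 4 * b^(n+1)/((n:ℝ)+1)),
          abs_of_nonneg (by positivity : 0 ≤ b^(n+1))]
        calc _ ≤ 4 * b^(n+1)/((n:ℝ)+1) :=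
              mul_le_of_le_one_right (by have := hbd n; positivity) (Real.abs_sin_le_one _)
          _ ≤ _ := div_le_self (by positivity) (hbd n)) 
      (fun γ => hasSum_Sk hu γ) (fun γ => hasSum_Lk htu α γ)
    have h2 : ∑' n : ℕ, π/2 * (c^(n+1) * (4 * b^(n+1)/(n+1)))
          * sin (((n+1 : ℕ) : ℝ) * α) = ∫ γ in (0:ℝ)..π, Sk u γ * Lk (t-u) α γ := by
      rw [← h.tsum_eq]; congr 1; ext n; ring
    rw [h2, intervalIntegral.integral_of_le pi_pos.le, integral_Ioc_eq_integral_Ioo]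
    exact setIntegral_nonneg measurableSet_Ioo
      (fun γ hγ => mul_nonneg (Sk_nonneg hu hγ) (Lk_nonneg htu hα hγ))
  rw [setLIntegral_congr_fun measurableSet_Ioo (g := fun α => ENNReal.ofReal (Sk t α *
    ∑' n : ℕ, π/2 * (c^(n+1) * (4 * b^(n+1)/(n+1))) * sin (((n+1 : ℕ) : ℝ) * α)))
    (fun α hα => by
      simp only
      rw [inner α hα, ENNReal.ofReal_mul (Sk_nonneg ht hα)])]
  have hP := parseval (geo_summable ha0.le ha1) hd1 (fun γ => hasSum_Sk ht γ)
    (fun α => (hss α).hasSum)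
  rw [parseval_lint (geo_summable ha0.le ha1) hd1 (fun γ => hasSum_Sk ht γ)
    (fun α => (hss α).hasSum) (fun γ hγ => Sk_nonneg ht hγ) hnn]
  rw [ENNReal.ofReal_tsum_of_nonneg (fun n => by have := hbd n; positivity) hP.summable]
  congr 1; ext n
  congr 1
  have : exp (-(n+1) * (|t| + (|u| + |t-u|))) = a^(n+1) * (c^(n+1) * b^(n+1)) := by
    rw [ha, hb, hc, ← Real.exp_nat_mul, ← Real.exp_nat_mul, ← Real.exp_nat_mul, ← Real.exp_add,
      ← Real.exp_add]
    congr 1; push_cast; ring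
  rw [this]
  ring

lemma v_int {A B R : ℝ} (hB : 0 < B) (hR : 0 < R) (h : 0 < A - B*R) :
    ∫⁻ v in Set.Ioo (-R) R, ENNReal.ofReal ((A - B*v)⁻¹)
      = ENNReal.ofReal (1/B * log ((A + B*R)/(A - B*R))) := by
  have hpos : ∀ v ∈ Set.uIcc (-R) R, 0 < A - B*v := by
    intro v hv
    rw [Set.uIcc_of_le (by linarith)] at hv
    nlinarith [hv.2]
  have hpos' : 0 < A + B*R := by nlinarith
  have hd : ∀ v ∈ Set.uIcc (-R) R, HasDerivAt (fun v => -(1/B) * log (A - B*v)) ((A - B*v)⁻¹) v := by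
    intro v hv
    have h1 : HasDerivAt (fun v : ℝ => A - B*v) (-B) v := by
      simpa using ((hasDerivAt_id v).const_mul B).const_sub A
    refine ((h1.log (hpos v hv).ne').const_mul (-(1/B))).congr_deriv ?_
    have := (hpos v hv).ne'
    field_simp
  have hc : ContinuousOn (fun v => (A - B*v)⁻¹) (Set.uIcc (-R) R) :=
    ContinuousOn.inv₀ (by fun_prop) (fun v hv => (hpos v hv).ne')
  have hi : IntervalIntegrable (fun v => (A - B*v)⁻¹) volume (-R) R := hc.intervalIntegrable
  have e := intervalIntegral.integral_eq_sub_of_hasDerivAt hd hi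
  rw [intervalIntegral.integral_of_le (by linarith), integral_Ioc_eq_integral_Ioo] at e
  rw [← ofReal_integral_eq_lintegral_ofReal
    ((intervalIntegrable_iff_integrableOn_Ioo_of_le (by linarith)).1 hi), e]
  · rw [Real.log_div hpos'.ne' h.ne']
    congr 1
    rw [show A - B * -R = A + B*R by ring]
    ring
  · filter_upwards [ae_restrict_mem measurableSet_Ioo] with v hv
    have := hpos v (by rw [Set.uIcc_of_le (by linarith)]; exact Set.Ioo_subset_Icc_self hv)
    exact (inv_pos.2 this).le

lemma measurable_Sk : Measurable (fun p : ℝ × ℝ => Sk p.1 p.2) := by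
  unfold Sk; fun_prop

lemma measurable_Lk : Measurable (fun p : ℝ × ℝ × ℝ => Lk p.1 p.2.1 p.2.2) := by
  unfold Lk
  exact Measurable.log (by fun_prop)

/-- the triangle integral in terms of an orthonormal pair -/
def JJ (ω b : E4) (p : ℝ × ℝ) : ENNReal :=
  ∫⁻ z : E4, ENNReal.ofReal ((‖z‖^2)⁻¹ * (1 + ‖z‖^2 - 2 * inner ℝ ω z)⁻¹ *
    (p.2 + ‖z‖^2 - 2 * (p.1 * inner ℝ ω z + √(p.2 - p.1^2) * inner ℝ b z))⁻¹)

lemma measurable_JJ (ω b : E4) : Measurable (JJ ω b) := by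
  unfold JJ
  refine Measurable.lintegral_prod_right' (f := fun q : (ℝ × ℝ) × E4 =>
    ENNReal.ofReal ((‖q.2‖^2)⁻¹ * (1 + ‖q.2‖^2 - 2 * inner ℝ ω q.2)⁻¹ *
    (q.1.2 + ‖q.2‖^2 - 2 * (q.1.1 * inner ℝ ω q.2 + √(q.1.2 - q.1.1^2) * inner ℝ b q.2))⁻¹)) ?_
  fun_prop

lemma JJ_eq {ω b : E4} (hω : ‖ω‖ = 1) (hb : ‖b‖ = 1) (hωb : inner ℝ ω b = 0) (p : ℝ × ℝ) :
    JJ ω b p = ∫⁻ u : ℝ, ∫⁻ γ in Set.Ioo 0 π, ENNReal.ofReal (2*π*exp (3*u) * sin γ) *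
          ∫⁻ v in Set.Ioo (-(exp u * sin γ)) (exp u * sin γ),
            ENNReal.ofReal ((exp (2*u))⁻¹ * (1 + exp (2*u) - 2 * (exp u * cos γ))⁻¹ *
    (p.2 + exp (2*u) - 2 * (p.1 * (exp u * cos γ) + √(p.2 - p.1^2) * v))⁻¹) := by
  exact zonal ω b hω hb hωb (fun w => ENNReal.ofReal ((w.2.2)⁻¹ * (1 + w.2.2 - 2 * w.1)⁻¹ *
    (p.2 + w.2.2 - 2 * (p.1 * w.1 + √(p.2 - p.1^2) * w.2.1))⁻¹)) (by fun_prop)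

lemma exp_cosh_identity (t u θ : ℝ) :
    exp (2*t) + exp (2*u) - 2 * (exp t * exp u * cos θ)
      = 2 * exp t * exp u * (cosh (t-u) - cos θ) := by
  rw [Real.cosh_eq, neg_sub, Real.exp_sub, Real.exp_sub, two_mul t, two_mul u, Real.exp_add,
    Real.exp_add]
  have := exp_pos t
  have := exp_pos u
  field_simp

lemma JJ_polar {ω b : E4} (hω : ‖ω‖ = 1) (hb : ‖b‖ = 1) (hωb : inner ℝ ω b = 0)
    (t : ℝ) {α : ℝ} (hα : α ∈ Set.Ioo 0 π) :
    JJ ω b (exp t * cos α, exp (2*t)) = ENNReal.ofReal (π / (exp t * sin α)) *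
      ∫⁻ u : ℝ, ∫⁻ γ in Set.Ioo 0 π, ENNReal.ofReal (Sk u γ * Lk (t-u) α γ) := by
  have hsα := sin_pos_of_pos_of_lt_pi hα.1 hα.2
  have hexp2 : ∀ x : ℝ, exp (2*x) = exp x * exp x := fun x => by rw [two_mul, Real.exp_add]
  have hexp3 : ∀ x : ℝ, exp (3*x) = exp x * exp x * exp x := fun x => by
    rw [show 3*x = x+x+x by ring, Real.exp_add, Real.exp_add]
  have hsq : √(exp (2*t) - (exp t * cos α)^2) = exp t * sin α := by
    rw [Real.sqrt_eq_iff_mul_self_eq_of_pos (by positivity), hexp2]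
    linear_combination exp t^2 * Real.sin_sq_add_cos_sq α
  rw [JJ_eq hω hb hωb, ← lintegral_const_mul' _ _ ENNReal.ofReal_ne_top]
  refine lintegral_congr_ae ?_
  have hu0 : ∀ᵐ x : ℝ, x ≠ 0 := by simp [ae_iff]
  have hut : ∀ᵐ x : ℝ, x ≠ t := by simp [ae_iff]
  filter_upwards [hu0, hut] with u hu hut
  have htu : t - u ≠ 0 := sub_ne_zero.2 hut.symm
  rw [← lintegral_const_mul' _ _ ENNReal.ofReal_ne_top]
  refine setLIntegral_congr_fun measurableSet_Ioo ?_
  intro γ hγ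
  have hsγ := sin_pos_of_pos_of_lt_pi hγ.1 hγ.2
  simp only [hsq]
  have ht := exp_pos t
  have hue := exp_pos u
  set A := exp (2*t) + exp (2*u) - 2 * (exp t * exp u * (cos α * cos γ)) with hA
  have hm : A - (2 * (exp t * sin α)) * (exp u * sin γ)
      = 2 * exp t * exp u * (cosh (t-u) - cos (α-γ)) := by
    rw [← exp_cosh_identity, Real.cos_sub, hA]; ring
  have hp : A + (2 * (exp t * sin α)) * (exp u * sin γ)
      = 2 * exp t * exp u * (cosh (t-u) - cos (α+γ)) := by
    rw [← exp_cosh_identity, Real.cos_add, hA]; ring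
  have hcm := cosh_sub_cos_pos htu (α-γ)
  have hcp := cosh_sub_cos_pos htu (α+γ)
  have hcu := cosh_sub_cos_pos hu γ
  have h0 := exp_cosh_identity u 0 γ
  simp only [mul_zero, Real.exp_zero, mul_one, sub_zero] at h0
  have hden : 1 + exp (2*u) - 2 * (exp u * cos γ) = 2 * exp u * (cosh u - cos γ) := by
    rw [← h0]; ring
  have hc0 : 0 ≤ (exp (2*u))⁻¹ * (1 + exp (2*u) - 2 * (exp u * cos γ))⁻¹ := by
    rw [hden]; positivity
  have hv : ∀ v : ℝ, exp (2*t) + exp (2*u) - 2 * (exp t * cos α * (exp u * cos γ)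
      + exp t * sin α * v) = A - 2 * (exp t * sin α) * v := by
    intro v; rw [hA]; ring
  simp_rw [hv, ENNReal.ofReal_mul hc0]
  rw [lintegral_const_mul' _ _ ENNReal.ofReal_ne_top,
    v_int (by positivity) (by positivity) (by rw [hm]; positivity), hm, hp,
    mul_div_mul_left _ _ (by positivity), ← Lk, ← ENNReal.ofReal_mul hc0,
    ← ENNReal.ofReal_mul (by positivity), ← ENNReal.ofReal_mul (by positivity), hden, Sk, hexp2,
    hexp3]
  congr 1
  field_simp

lemma exists_perp (ω : E4) : ∃ b : E4, ‖b‖ = 1 ∧ inner ℝ ω b = 0 := by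
  have h : (Submodule.span ℝ {ω})ᗮ ≠ ⊥ := by
    intro h
    have h1 := Submodule.finrank_add_finrank_orthogonal (Submodule.span ℝ {ω})
    rw [h, finrank_bot] at h1
    have h2 := finrank_span_le_card (R := ℝ) ({ω} : Set E4)
    simp at h1 h2
    omega
  obtain ⟨x, hx, hx0⟩ := Submodule.exists_mem_ne_zero_of_ne_bot h
  refine ⟨(‖x‖)⁻¹ • x, norm_smul_inv_norm (𝕜 := ℝ) hx0, ?_⟩
  rw [inner_smul_right, Submodule.mem_orthogonal_singleton_iff_inner_right.1 hx, mul_zero]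

def hk (ω y z : E4) : ℝ :=
  (‖y‖^2)⁻¹ * (‖z‖^2)⁻¹ * (‖ω - y‖^2)⁻¹ * (‖y - z‖^2)⁻¹ * (‖ω - z‖^2)⁻¹

lemma inner_J {ω b : E4} (hω : ‖ω‖ = 1) (hb : ‖b‖ = 1) (hωb : inner ℝ ω b = 0) {y : E4}
    (hy : y ∉ Submodule.span ℝ {ω}) :
    ∫⁻ z, ENNReal.ofReal (hk ω y z) =
      ENNReal.ofReal ((‖y‖^2)⁻¹ * (1 + ‖y‖^2 - 2 * inner ℝ ω y)⁻¹) *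
        JJ ω b (inner ℝ ω y, ‖y‖^2) := by
  have hsub : ∀ x : E4, ‖ω - x‖^2 = 1 + ‖x‖^2 - 2 * inner ℝ ω x := by
    intro x; rw [norm_sub_sq_real, hω]; ring
  set y0 : ℝ := inner ℝ ω y with hy0
  set w : E4 := y - y0 • ω with hw
  have hwn : w ≠ 0 := by
    intro h
    apply hy
    rw [Submodule.mem_span_singleton]
    exact ⟨y0, (sub_eq_zero.1 h).symm⟩
  have hωω : inner ℝ ω ω = (1:ℝ) := by rw [real_inner_self_eq_norm_sq, hω]; norm_num
  have hωw : inner ℝ ω w = 0 := by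
    rw [hw, inner_sub_right, inner_smul_right, hωω, ← hy0]; ring
  have hw2 : ‖w‖^2 = ‖y‖^2 - y0^2 := by
    rw [hw, norm_sub_sq_real, inner_smul_right, norm_smul, hω, real_inner_comm, ← hy0,
      Real.norm_eq_abs, mul_one, sq_abs]; ring
  have hrho : √(‖y‖^2 - y0^2) = ‖w‖ := by rw [← hw2, Real.sqrt_sq (norm_nonneg _)]
  have hwp : 0 < ‖w‖ := norm_pos_iff.2 hwn
  set b' : E4 := (‖w‖)⁻¹ • w with hb'
  have hb'1 : ‖b'‖ = 1 := norm_smul_inv_norm (𝕜 := ℝ) hwn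
  have hωb' : inner ℝ ω b' = 0 := by rw [hb', inner_smul_right, hωw, mul_zero]
  have hyz : ∀ z : E4, inner ℝ y z = y0 * inner ℝ ω z + ‖w‖ * inner ℝ b' z := by
    intro z
    have : y = y0 • ω + ‖w‖ • b' := by
      rw [hb', smul_smul, mul_inv_cancel₀ hwp.ne', one_smul, hw]; abel
    conv_lhs => rw [this]
    rw [inner_add_left, real_inner_smul_left, real_inner_smul_left]
  have hdist : ∀ z : E4, ‖y‖^2 + ‖z‖^2 - 2 * inner ℝ y z = ‖y - z‖^2 := by
    intro z; rw [norm_sub_sq_real]; ring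
  have hJ : JJ ω b (y0, ‖y‖^2) = JJ ω b' (y0, ‖y‖^2) := by
    rw [JJ_eq hω hb hωb, JJ_eq hω hb'1 hωb']
  rw [hJ, JJ, ← lintegral_const_mul' _ _ ENNReal.ofReal_ne_top]
  congr 1; ext z
  simp only [hrho]
  rw [← hyz, ← hsub z, hy0, ← hsub y, hdist z, ← ENNReal.ofReal_mul (by positivity)]
  congr 1
  rw [hk]
  ring

theorem period {ω : E4} (hω : ‖ω‖ = 1) :
    ∫⁻ y, ∫⁻ z, ENNReal.ofReal (hk ω y z) = ENNReal.ofReal (6 * π^4 * zeta3) := by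
  obtain ⟨b, hb, hωb⟩ := exists_perp ω
  have hae : ∀ᵐ y : E4, y ∉ Submodule.span ℝ {ω} := by
    have h := Measure.addHaar_submodule (volume : Measure E4) (Submodule.span ℝ {ω}) (by
      intro h
      have h2 := finrank_span_le_card (R := ℝ) ({ω} : Set E4)
      rw [h] at h2
      simp at h2)
    simpa [ae_iff] using h
  have e1 : ∫⁻ y, ∫⁻ z, ENNReal.ofReal (hk ω y z) = ∫⁻ y : E4,
      ENNReal.ofReal ((‖y‖^2)⁻¹ * (1 + ‖y‖^2 - 2 * inner ℝ ω y)⁻¹) *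
        JJ ω b (inner ℝ ω y, ‖y‖^2) := by
    refine lintegral_congr_ae ?_
    filter_upwards [hae] with y hy using inner_J hω hb hωb hy
  have hJm := measurable_JJ ω b
  rw [e1, zonal ω b hω hb hωb (fun w => ENNReal.ofReal ((w.2.2)⁻¹ * (1 + w.2.2 - 2 * w.1)⁻¹) *
    JJ ω b (w.1, w.2.2)) (by fun_prop)]
  have hS := measurable_Sk
  have hL := measurable_Lk
  have e2 : ∀ t : ℝ, t ≠ 0 → ∫⁻ α in Set.Ioo 0 π, ENNReal.ofReal (2*π*exp (3*t) * sin α) *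
          ∫⁻ u in Set.Ioo (-(exp t * sin α)) (exp t * sin α),
            ENNReal.ofReal ((exp (2*t))⁻¹ * (1 + exp (2*t) - 2 * (exp t * cos α))⁻¹) *
              JJ ω b (exp t * cos α, exp (2*t))
      = ENNReal.ofReal (4*π^2) * ∫⁻ u : ℝ, ∑' n : ℕ, ENNReal.ofReal (π^2 / (n+1)
      * exp (-(n+1) * (|t| + (|u| + |t-u|)))) := by
    intro t ht
    have e3 : ∫⁻ α in Set.Ioo 0 π, ENNReal.ofReal (2*π*exp (3*t) * sin α) *
          ∫⁻ u in Set.Ioo (-(exp t * sin α)) (exp t * sin α),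
            ENNReal.ofReal ((exp (2*t))⁻¹ * (1 + exp (2*t) - 2 * (exp t * cos α))⁻¹) *
              JJ ω b (exp t * cos α, exp (2*t))
        = ∫⁻ α in Set.Ioo 0 π, ENNReal.ofReal (4*π^2) * ∫⁻ u : ℝ, (ENNReal.ofReal (Sk t α) *
            ∫⁻ γ in Set.Ioo 0 π, ENNReal.ofReal (Sk u γ * Lk (t-u) α γ)) := by
      refine setLIntegral_congr_fun measurableSet_Ioo ?_
      intro α hα
      have hsα := sin_pos_of_pos_of_lt_pi hα.1 hα.2
      have hct := cosh_sub_cos_pos ht α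
      have het := exp_pos t
      simp only
      rw [setLIntegral_const, Real.volume_Ioo, JJ_polar hω hb hωb t hα,
        lintegral_const_mul' _ _ ENNReal.ofReal_ne_top]
      have h0 := exp_cosh_identity t 0 α
      simp only [mul_zero, Real.exp_zero, mul_one, sub_zero] at h0
      have hden : 1 + exp (2*t) - 2 * (exp t * cos α) = 2 * exp t * (cosh t - cos α) := by
        rw [← h0]; ring
      rw [hden, mul_right_comm _ _ (ENNReal.ofReal (exp t * sin α - _)), ← mul_assoc, ← mul_assoc,
        ← mul_assoc]
      have hSk : 0 ≤ Sk t α := Sk_nonneg ht hα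
      rw [← ENNReal.ofReal_mul (by positivity), ← ENNReal.ofReal_mul (by positivity),
        ← ENNReal.ofReal_mul (by
          have : 0 ≤ exp t * sin α - -(exp t * sin α) := by
            rw [sub_neg_eq_add]; positivity
          positivity), ← mul_assoc (ENNReal.ofReal (4*π^2)),
        ← ENNReal.ofReal_mul (by positivity)]
      congr 2
      rw [show 3*t = t+t+t by ring, show 2*t = t+t by ring, Real.exp_add, Real.exp_add, Sk]
      field_simp
      ring
    rw [e3, lintegral_const_mul' _ _ ENNReal.ofReal_ne_top]
    congr 1
    rw [lintegral_lintegral_swap]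
    · refine lintegral_congr_ae ?_
      have hu0 : ∀ᵐ x : ℝ, x ≠ 0 := by simp [ae_iff]
      have hut : ∀ᵐ x : ℝ, x ≠ t := by simp [ae_iff]
      filter_upwards [hu0, hut] with u hu hut
      exact angular ht hu (sub_ne_zero.2 hut.symm)
    · refine Measurable.aemeasurable ?_
      refine Measurable.mul ?_ ?_
      · exact (hS.comp (f := fun p : ℝ × ℝ => (t, p.1)) (by fun_prop)).ennreal_ofReal
      · refine Measurable.lintegral_prod_right' (f := fun q : (ℝ × ℝ) × ℝ =>
          ENNReal.ofReal (Sk q.1.2 q.2 * Lk (t - q.1.2) q.1.1 q.2)) ?_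
        refine Measurable.ennreal_ofReal (Measurable.mul ?_ ?_)
        · exact hS.comp (f := fun q : (ℝ × ℝ) × ℝ => (q.1.2, q.2)) (by fun_prop)
        · exact hL.comp (f := fun q : (ℝ × ℝ) × ℝ => (t - q.1.2, q.1.1, q.2)) (by fun_prop)
  have hae0 : ∀ᵐ x : ℝ, x ≠ 0 := by simp [ae_iff]
  rw [lintegral_congr_ae (g := fun t => ENNReal.ofReal (4*π^2) *
    ∫⁻ u : ℝ, ∑' n : ℕ, ENNReal.ofReal (π^2 / (n+1)
      * exp (-(n+1) * (|t| + (|u| + |t-u|)))))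
    (by filter_upwards [hae0] with t ht using e2 t ht),
    lintegral_const_mul' _ _ ENNReal.ofReal_ne_top, core_radial, ← ENNReal.ofReal_mul (by positivity)]
  congr 1
  ring


abbrev S3 := Metric.sphere (0 : E4) 1

abbrev sig : Measure S3 := (volume : Measure E4).toSphere

lemma sig_univ : sig Set.univ = ENNReal.ofReal (2 * π^2) := by
  rw [Measure.toSphere_apply_univ, InnerProductSpace.volume_ball_of_dim_even (k := 2) (by simp)]
  simp only [finrank_euclideanSpace, Fintype.card_fin]
  have : ((4:ℕ) : ENNReal) = ENNReal.ofReal 4 := by simp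
  rw [this, ← ENNReal.ofReal_pow (by norm_num), ← ENNReal.ofReal_mul (by norm_num),
    ← ENNReal.ofReal_mul (by norm_num)]
  congr 1
  simp [Nat.factorial]
  ring

lemma polar_lint (g : E4 → ENNReal) (hg : Measurable g) :
    ∫⁻ x, g x = ∫⁻ ω : S3, ∫⁻ r in Set.Ioi (0:ℝ), ENNReal.ofReal (r^3) * g (r • (ω : E4)) ∂volume ∂sig := by
  have hmp := Measure.measurePreserving_homeomorphUnitSphereProd (volume : Measure E4)
  have h1 : ∫⁻ x, g x = ∫⁻ x : ({0}ᶜ : Set E4), g x ∂(Measure.comap (↑) (volume : Measure E4)) := by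
    rw [lintegral_subtype_comap (MeasurableSet.singleton 0).compl g, restrict_compl_singleton]
  rw [h1]
  have h2 : ∀ x : ({0}ᶜ : Set E4), g x = (fun p : S3 × Set.Ioi (0:ℝ) => g ((p.2 : ℝ) • (p.1 : E4))) (homeomorphUnitSphereProd E4 x) := by
    intro x
    have := homeomorphUnitSphereProd_symm_apply_coe E4 (homeomorphUnitSphereProd E4 x)
    simp only [Homeomorph.symm_apply_apply] at this
    exact congrArg g this
  have hm : Measurable (fun p : S3 × Set.Ioi (0:ℝ) => g ((p.2 : ℝ) • (p.1 : E4))) := by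
    apply hg.comp
    fun_prop
  simp_rw [h2]
  rw [hmp.lintegral_comp hm, lintegral_prod _ hm.aemeasurable]
  refine lintegral_congr fun ω => ?_
  simp only [finrank_euclideanSpace, Fintype.card_fin]
  rw [Measure.volumeIoiPow, lintegral_withDensity_eq_lintegral_mul _ (by fun_prop) (g := fun y : Set.Ioi (0:ℝ) => g ((y:ℝ) • (ω:E4))) (hm.comp measurable_prodMk_left)]
  exact lintegral_subtype_comap measurableSet_Ioi (fun r : ℝ => ENNReal.ofReal (r^3) * g (r • (ω:E4)))

lemma scale_lint (G : E4 × E4 → ENNReal) (hG : Measurable G) {r : ℝ} (hr : 0 < r) :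
    ∫⁻ q, G q = ENNReal.ofReal (r^8) * ∫⁻ q, G (r • q) := by
  have : (volume : Measure (E4×E4)).IsAddHaarMeasure := by
    rw [Measure.volume_eq_prod]; infer_instance
  have h := Measure.map_addHaar_smul (volume : Measure (E4×E4)) hr.ne'
  have h3 : Module.finrank ℝ (E4 × E4) = 8 := by simp
  rw [h3] at h
  have h2 : ∫⁻ q, G (r • q) = ENNReal.ofReal (|(r^8)⁻¹|) * ∫⁻ q, G q := by
    rw [← lintegral_map (f := G) (g := fun q => r • q) hG (by fun_prop), h, lintegral_smul_measure, smul_eq_mul]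
  rw [h2, ← mul_assoc, ← ENNReal.ofReal_mul (by positivity), abs_of_pos (by positivity),
    mul_inv_cancel₀ (by positivity)]
  simp

instance volEE_sigmaFinite : SigmaFinite (volume : Measure (E4 × E4)) := by
  rw [Measure.volume_eq_prod]; infer_instance

instance sigEE_sigmaFinite : SigmaFinite (sig.prod (volume : Measure (E4 × E4))) :=
  Measure.prod.instSigmaFinite

abbrev MM : Measure ((S3 × (E4 × E4)) × ℝ) :=
  (sig.prod (volume : Measure (E4 × E4))).prod (volume.restrict (Set.Ioi 0))

def Phi (p : (S3 × (E4 × E4)) × ℝ) : E4 × E4 × E4 := (p.2 • (p.1.1 : E4), p.2 • p.1.2)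

lemma Phi_meas : Measurable Phi := by unfold Phi; fun_prop

lemma vol_eq_aux (F : E4 × E4 × E4 → ENNReal) (hF : Measurable F) (ω : S3) :
    ∫⁻ r in Set.Ioi (0:ℝ), ENNReal.ofReal (r^3) * ∫⁻ q : E4 × E4, F (r • (ω : E4), q) =
    ∫⁻ q : E4 × E4, ∫⁻ r in Set.Ioi (0:ℝ), ENNReal.ofReal (r^11) * F (Phi ((ω, q), r)) := by
  have hF2 : Measurable (fun p : (E4 × E4) × ℝ => F (Phi ((ω, p.1), p.2))) :=
    hF.comp (Phi_meas.comp (by fun_prop))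
  have hm2 : Measurable (fun p : (E4 × E4) × ℝ => ENNReal.ofReal (p.2^11) * F (Phi ((ω, p.1), p.2))) :=
    (by fun_prop : Measurable (fun p : (E4 × E4) × ℝ => ENNReal.ofReal (p.2^11))).mul hF2
  rw [lintegral_lintegral_swap (f := fun q r => ENNReal.ofReal (r^11) * F (Phi ((ω, q), r))) hm2.aemeasurable]
  refine setLIntegral_congr_fun measurableSet_Ioi fun r hr => ?_
  have hr : 0 < r := hr
  have h1 : Measurable (fun q : E4 × E4 => F (r • (ω : E4), q)) := hF.comp measurable_prodMk_left
  have h2 : Measurable (fun q : E4 × E4 => F (Phi ((ω, q), r))) :=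
    hF2.comp (measurable_prodMk_right (y := r))
  change ENNReal.ofReal (r^3) * ∫⁻ q : E4 × E4, F (r • (ω : E4), q) =
    ∫⁻ q : E4 × E4, ENNReal.ofReal (r^11) * F (Phi ((ω, q), r))
  rw [lintegral_const_mul _ h2, scale_lint _ h1 hr, ← mul_assoc, ← ENNReal.ofReal_mul (by positivity),
    ← pow_add]
  rfl

lemma vol_eq : (volume : Measure (E4 × E4 × E4)) =
    Measure.map Phi (MM.withDensity (fun p => ENNReal.ofReal (p.2 ^ 11))) := by
  refine Measure.ext_of_lintegral _ fun F hF => ?_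
  rw [lintegral_map hF Phi_meas, lintegral_withDensity_eq_lintegral_mul _ (by fun_prop)
    (g := fun a => F (Phi a)) (hF.comp Phi_meas)]
  have hm : Measurable (fun p : (S3 × (E4 × E4)) × ℝ => ENNReal.ofReal (p.2^11) * F (Phi p)) :=
    (by fun_prop : Measurable (fun p : (S3 × (E4 × E4)) × ℝ => ENNReal.ofReal (p.2^11))).mul (hF.comp Phi_meas)
  simp only [Pi.mul_apply]
  rw [lintegral_prod _ hm.aemeasurable,
    lintegral_prod _ (hm.lintegral_prod_right').aemeasurable, Measure.volume_eq_prod,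
    lintegral_prod _ hF.aemeasurable, polar_lint _ hF.lintegral_prod_right']
  refine lintegral_congr fun ω => ?_
  exact vol_eq_aux F hF ω

section ray
variable {V : Type*} [NormedAddCommGroup V] [NormedSpace ℝ V]

lemma fderiv_bound (φ : SchwartzMap V ℝ) :
    ∃ C : ℝ, 0 < C ∧ ∀ x, ‖fderiv ℝ φ x‖ ≤ C * ((1 + ‖x‖)^2)⁻¹ := by
  obtain ⟨C0, h0, H0⟩ := φ.decay 0 1
  obtain ⟨C2, h2, H2⟩ := φ.decay 2 1
  refine ⟨2 * (C0 + C2), by positivity, fun x => ?_⟩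
  have a := H0 x
  have b := H2 x
  rw [norm_iteratedFDeriv_one] at a b
  rw [← div_eq_mul_inv, le_div_iff₀ (by positivity)]
  have : (1 + ‖x‖)^2 ≤ 2 * (1 + ‖x‖^2) := by nlinarith [sq_nonneg (1 - ‖x‖)]
  calc _ ≤ ‖fderiv ℝ φ x‖ * (2 * (1 + ‖x‖^2)) := by gcongr
    _ ≤ _ := by simp at a; linarith

lemma ray_dom {a : ℝ} (ha : 0 < a) :
    IntegrableOn (fun r : ℝ => a * ((1 + r * a)^2)⁻¹) (Set.Ioi 0) ∧
    ∫ r in Set.Ioi (0:ℝ), a * ((1 + r * a)^2)⁻¹ = 1 := by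
  have hd : ∀ x ∈ Set.Ici (0:ℝ), HasDerivAt (fun r : ℝ => -(1 + r * a)⁻¹) (a * ((1 + x * a)^2)⁻¹) x := by
    intro x hx
    have hx : 0 ≤ x := hx
    have h1 : HasDerivAt (fun r : ℝ => 1 + r * a) a x := by
      simpa using ((hasDerivAt_id x).mul_const a).const_add 1
    have := (h1.inv (by positivity)).neg
    rw [neg_div, neg_neg, div_eq_mul_inv] at this
    exact this
  have hp : ∀ x ∈ Set.Ioi (0:ℝ), 0 ≤ a * ((1 + x * a)^2)⁻¹ := fun x hx => by positivity
  have ht : Filter.Tendsto (fun r : ℝ => -(1 + r * a)⁻¹) Filter.atTop (nhds 0) := by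
    rw [← neg_zero]
    refine Filter.Tendsto.neg (Filter.Tendsto.comp tendsto_inv_atTop_zero ?_)
    exact Filter.tendsto_atTop_add_const_left _ _ (Filter.tendsto_id.atTop_mul_const ha)
  refine ⟨integrableOn_Ioi_deriv_of_nonneg' hd hp ht, ?_⟩
  rw [integral_Ioi_of_hasDerivAt_of_nonneg' hd hp ht]
  simp

lemma ray (φ : SchwartzMap V ℝ) : ∃ C : ℝ, 0 < C ∧ ∀ P : V, P ≠ 0 →
    IntegrableOn (fun r : ℝ => fderiv ℝ φ (r • P) P) (Set.Ioi 0) ∧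
    ∫ r in Set.Ioi (0:ℝ), ‖fderiv ℝ φ (r • P) P‖ ≤ C ∧
    ∫ r in Set.Ioi (0:ℝ), fderiv ℝ φ (r • P) P = - φ 0 := by
  obtain ⟨C, hC, H⟩ := fderiv_bound φ
  refine ⟨C, hC, fun P hP => ?_⟩
  have ha : 0 < ‖P‖ := norm_pos_iff.mpr hP
  obtain ⟨hI, hv⟩ := ray_dom ha
  have hcont : Continuous (fun r : ℝ => fderiv ℝ φ (r • P) P) := by
    have : Continuous (fderiv ℝ φ) := (φ.smooth 1).continuous_fderiv (by simp)
    exact (this.comp (by fun_prop)).clm_apply continuous_const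
  have hb : ∀ r ∈ Set.Ioi (0:ℝ), ‖fderiv ℝ φ (r • P) P‖ ≤ C * (‖P‖ * ((1 + r * ‖P‖)^2)⁻¹) := by
    intro r hr
    have hr : 0 < r := hr
    have h1 := H (r • P)
    rw [norm_smul, Real.norm_of_nonneg hr.le] at h1
    calc _ ≤ ‖fderiv ℝ φ (r • P)‖ * ‖P‖ := ContinuousLinearMap.le_opNorm _ _
      _ ≤ (C * ((1 + r * ‖P‖)^2)⁻¹) * ‖P‖ := by gcongr
      _ = _ := by ring
  have hint : IntegrableOn (fun r : ℝ => fderiv ℝ φ (r • P) P) (Set.Ioi 0) := by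
    refine Integrable.mono' (hI.const_mul C) hcont.aestronglyMeasurable ?_
    filter_upwards [ae_restrict_mem measurableSet_Ioi] with r hr using hb r hr
  refine ⟨hint, ?_, ?_⟩
  · calc _ ≤ ∫ r in Set.Ioi (0:ℝ), C * (‖P‖ * ((1 + r * ‖P‖)^2)⁻¹) :=
          setIntegral_mono_on hint.norm (hI.const_mul C) measurableSet_Ioi hb
      _ = C := by rw [integral_const_mul, hv, mul_one]
  · have hd : ∀ x ∈ Set.Ici (0:ℝ), HasDerivAt (fun r : ℝ => φ (r • P)) (fderiv ℝ φ (x • P) P) x := by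
      intro x _
      have h1 : HasFDerivAt φ (fderiv ℝ φ (x • P)) (x • P) :=
        (φ.differentiableAt).hasFDerivAt
      have h2 : HasDerivAt (fun r : ℝ => r • P) P x := by
        simpa using (hasDerivAt_id x).smul_const P
      exact h1.comp_hasDerivAt x h2
    have ht : Filter.Tendsto (fun r : ℝ => φ (r • P)) Filter.atTop (nhds 0) := by
      obtain ⟨C1, h1, H1⟩ := φ.decay 1 0
      refine squeeze_zero_norm' (a := fun r : ℝ => (C1 / ‖P‖) * r⁻¹) ?_ ?_
      · filter_upwards [Filter.eventually_gt_atTop 0] with r hr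
        have := H1 (r • P)
        rw [norm_iteratedFDeriv_zero, pow_one, norm_smul, Real.norm_of_nonneg hr.le] at this
        rw [div_mul_eq_mul_div, le_div_iff₀ ha, ← div_eq_mul_inv, le_div_iff₀ hr]
        linarith
      · simpa using tendsto_inv_atTop_zero.const_mul (C1 / ‖P‖)
    rw [integral_Ioi_of_hasDerivAt_of_tendsto' hd hint ht]
    simp
end ray

lemma hk_nonneg (ω y z : E4) : 0 ≤ hk ω y z := by unfold hk; positivity

lemma hk_meas : Measurable (fun p : S3 × (E4 × E4) => hk p.1 p.2.1 p.2.2) := by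
  unfold hk; fun_prop

lemma zeta3_nonneg : 0 ≤ zeta3 := tsum_nonneg fun n => by positivity

lemma hk_lint : ∫⁻ p : S3 × (E4 × E4), ENNReal.ofReal (hk p.1 p.2.1 p.2.2)
    ∂(sig.prod (volume : Measure (E4 × E4))) = ENNReal.ofReal (12 * π^6 * zeta3) := by
  rw [lintegral_prod _ hk_meas.ennreal_ofReal.aemeasurable]
  have : ∀ ω : S3, ∫⁻ q : E4 × E4, ENNReal.ofReal (hk ω q.1 q.2) = ENNReal.ofReal (6 * π^4 * zeta3) := by
    intro ω
    have hmm : Measurable (fun q : E4 × E4 => ENNReal.ofReal (hk ω q.1 q.2)) :=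
      (hk_meas.comp (measurable_prodMk_left (x := ω))).ennreal_ofReal
    rw [Measure.volume_eq_prod, lintegral_prod _ hmm.aemeasurable]
    exact period (by simp)
  simp_rw [this]
  rw [lintegral_const, sig_univ, ← ENNReal.ofReal_mul (by have := zeta3_nonneg; positivity)]
  congr 1; ring

lemma hk_int : Integrable (fun p : S3 × (E4 × E4) => hk p.1 p.2.1 p.2.2)
    (sig.prod (volume : Measure (E4 × E4))) := by
  refine ⟨hk_meas.aestronglyMeasurable, ?_⟩
  rw [hasFiniteIntegral_iff_ofReal (Filter.Eventually.of_forall fun p => hk_nonneg _ _ _), hk_lint]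
  exact ENNReal.ofReal_lt_top

lemma hk_val : ∫ p : S3 × (E4 × E4), hk p.1 p.2.1 p.2.2
    ∂(sig.prod (volume : Measure (E4 × E4))) = 12 * π^6 * zeta3 := by
  rw [integral_eq_lintegral_of_nonneg_ae (Filter.Eventually.of_forall fun p => hk_nonneg _ _ _)
    hk_meas.aestronglyMeasurable, hk_lint, ENNReal.toReal_ofReal]
  have := zeta3_nonneg; positivity

abbrev inc (p : S3 × (E4 × E4)) : E4 × E4 × E4 := ((p.1 : E4), p.2)

lemma inc_ne (p : S3 × (E4 × E4)) : inc p ≠ 0 := by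
  intro h
  have h1 : (p.1 : E4) = 0 := congrArg Prod.fst h
  have h2 : ‖(p.1 : E4)‖ = 1 := by simp
  rw [h1] at h2
  simp at h2

lemma MM_int (φ : SchwartzMap (E4 × E4 × E4) ℝ) :
    Integrable (fun p : (S3 × (E4 × E4)) × ℝ =>
      hk p.1.1 p.1.2.1 p.1.2.2 * fderiv ℝ φ (p.2 • inc p.1) (inc p.1)) MM ∧
    ∫ p : (S3 × (E4 × E4)) × ℝ,
      hk p.1.1 p.1.2.1 p.1.2.2 * fderiv ℝ φ (p.2 • inc p.1) (inc p.1) ∂MM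
      = -12 * π^6 * zeta3 * φ 0 := by
  obtain ⟨C, hC, H⟩ := ray φ
  have hcont : Continuous (fun p : (S3 × (E4 × E4)) × ℝ => fderiv ℝ φ (p.2 • inc p.1) (inc p.1)) := by
    have : Continuous (fderiv ℝ φ) := (φ.smooth 1).continuous_fderiv (by simp)
    exact (this.comp (by fun_prop)).clm_apply (by fun_prop)
  have hm : Measurable (fun p : (S3 × (E4 × E4)) × ℝ =>
      hk p.1.1 p.1.2.1 p.1.2.2 * fderiv ℝ φ (p.2 • inc p.1) (inc p.1)) :=
    (hk_meas.comp measurable_fst).mul hcont.measurable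
  have hI : Integrable (fun p : (S3 × (E4 × E4)) × ℝ =>
      hk p.1.1 p.1.2.1 p.1.2.2 * fderiv ℝ φ (p.2 • inc p.1) (inc p.1)) MM := by
    rw [integrable_prod_iff hm.aestronglyMeasurable]
    constructor
    · exact Filter.Eventually.of_forall fun p => ((H (inc p) (inc_ne p)).1).const_mul (hk p.1 p.2.1 p.2.2)
    · refine Integrable.mono' (hk_int.const_mul C) hm.aestronglyMeasurable.norm.integral_prod_right' ?_
      refine Filter.Eventually.of_forall fun p => ?_
      simp only [norm_mul]
      rw [integral_const_mul, norm_mul, norm_norm, Real.norm_of_nonneg (hk_nonneg _ _ _),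
        Real.norm_of_nonneg (integral_nonneg fun _ => norm_nonneg _), mul_comm]
      exact mul_le_mul_of_nonneg_right (H (inc p) (inc_ne p)).2.1 (hk_nonneg _ _ _)
  refine ⟨hI, ?_⟩
  rw [integral_prod _ hI]
  have : ∀ p : S3 × (E4 × E4), ∫ r in Set.Ioi (0:ℝ), hk p.1 p.2.1 p.2.2 * fderiv ℝ φ (r • inc p) (inc p)
      = hk p.1 p.2.1 p.2.2 * (- φ 0) := by
    intro p
    rw [integral_const_mul, (H (inc p) (inc_ne p)).2.2]
  simp_rw [this]
  rw [integral_mul_const, hk_val]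
  ring

def ff (φ : SchwartzMap (E4 × E4 × E4) ℝ) (p : E4 × E4 × E4) : ℝ :=
  ‖p.1‖ ^ (-(2 : ℝ)) * ‖p.2.1‖ ^ (-(2 : ℝ)) * ‖p.2.2‖ ^ (-(2 : ℝ)) *
          ‖p.1 - p.2.1‖ ^ (-(2 : ℝ)) * ‖p.2.1 - p.2.2‖ ^ (-(2 : ℝ)) *
          ‖p.1 - p.2.2‖ ^ (-(2 : ℝ)) * fderiv ℝ (⇑φ) p p

lemma ff_meas (φ : SchwartzMap (E4 × E4 × E4) ℝ) : Measurable (ff φ) := by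
  have h1 : Continuous (fderiv ℝ φ) := (φ.smooth 1).continuous_fderiv (by simp)
  have h2 : Measurable (fun p => fderiv ℝ (⇑φ) p p) := (h1.clm_apply continuous_id).measurable
  unfold ff
  fun_prop

lemma ff_Phi (φ : SchwartzMap (E4 × E4 × E4) ℝ) (p : (S3 × (E4 × E4)) × ℝ) (hr : 0 < p.2) :
    (ENNReal.ofReal (p.2^11)).toReal • ff φ (Phi p) =
      hk p.1.1 p.1.2.1 p.1.2.2 * fderiv ℝ φ (p.2 • inc p.1) (inc p.1) := by
  obtain ⟨⟨ω, y, z⟩, r⟩ := p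
  simp only at hr
  have hPhi : Phi ((ω, y, z), r) = r • inc (ω, y, z) := rfl
  have hω : ‖(ω : E4)‖ = 1 := by simp
  have e : ∀ x : E4, ‖r • x‖ ^ (-(2:ℝ)) = (r^2)⁻¹ * (‖x‖^2)⁻¹ := by
    intro x
    rw [Real.rpow_neg (norm_nonneg _), Real.rpow_two, norm_smul, Real.norm_of_nonneg hr.le, mul_pow,
      mul_inv]
  rw [ENNReal.toReal_ofReal (by positivity), hPhi]
  unfold ff hk
  simp only [inc, Prod.smul_mk, ← smul_sub, e, hω]
  have : fderiv ℝ φ (r • (ω : E4), r • y, r • z) (r • (ω : E4), r • y, r • z)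
      = r * fderiv ℝ φ (r • (ω : E4), r • y, r • z) ((ω : E4), y, z) := by
    rw [← smul_eq_mul, ← map_smul]; rfl
  rw [this, smul_eq_mul]
  have hr' : r ≠ 0 := hr.ne'
  generalize (‖y‖^2)⁻¹ = a
  generalize (‖z‖^2)⁻¹ = b
  generalize (‖(ω:E4) - y‖^2)⁻¹ = c
  generalize (‖y - z‖^2)⁻¹ = d
  generalize (‖(ω:E4) - z‖^2)⁻¹ = f
  field_simp

lemma main_aux (φ : SchwartzMap (E4 × E4 × E4) ℝ) :
    Integrable (ff φ) ∧ ∫ p, ff φ p = -12 * π^6 * zeta3 * φ 0 := by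
  obtain ⟨hI, hv⟩ := MM_int φ
  have hae : ∀ᵐ p ∂MM, 0 < p.2 := by
    have h : ∀ᵐ r ∂(volume.restrict (Set.Ioi (0:ℝ))), 0 < r := ae_restrict_mem measurableSet_Ioi
    exact Measure.quasiMeasurePreserving_snd.ae h
  have hc : (fun p => (ENNReal.ofReal (p.2^11)).toReal • ff φ (Phi p)) =ᵐ[MM]
      fun p => hk p.1.1 p.1.2.1 p.1.2.2 * fderiv ℝ φ (p.2 • inc p.1) (inc p.1) := by
    filter_upwards [hae] with p hp using ff_Phi φ p hp
  have hd : Measurable (fun p : (S3 × (E4 × E4)) × ℝ => ENNReal.ofReal (p.2^11)) := by fun_prop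
  have hlt : ∀ᵐ p ∂MM, ENNReal.ofReal (p.2^11) < ⊤ := Filter.Eventually.of_forall fun p => ENNReal.ofReal_lt_top
  rw [vol_eq]
  constructor
  · rw [integrable_map_measure (ff_meas φ).aestronglyMeasurable Phi_meas.aemeasurable,
      integrable_withDensity_iff_integrable_smul' hd hlt]
    exact hI.congr hc.symm
  · rw [integral_map Phi_meas.aemeasurable (ff_meas φ).aestronglyMeasurable,
      integral_withDensity_eq_integral_toReal_smul hd hlt, integral_congr_ae hc, hv]

/-- the residue of the primitive tetrahedron graph of massless `φ⁴`
theory in four dimensions: for every Schwartz function `φ` on `ℝ^4 × ℝ^4 × ℝ^4`,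
`∫ |x|^{-2}|y|^{-2}|z|^{-2}|x-y|^{-2}|y-z|^{-2}|x-z|^{-2} (Eφ)(x,y,z) dx dy dz
  = -12 π⁶ ζ(3) φ(0,0,0)`, where `(Eφ)(x,y,z) = (x·∇_x + y·∇_y + z·∇_z)φ(x,y,z)`
is the Euler operator; the integral is absolutely convergent. -/
theorem stmt_19
    (φ : SchwartzMap (EuclideanSpace ℝ (Fin 4) × EuclideanSpace ℝ (Fin 4) ×
      EuclideanSpace ℝ (Fin 4)) ℝ) :
    Integrable (fun p : EuclideanSpace ℝ (Fin 4) × EuclideanSpace ℝ (Fin 4) ×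
        EuclideanSpace ℝ (Fin 4) =>
        ‖p.1‖ ^ (-(2 : ℝ)) * ‖p.2.1‖ ^ (-(2 : ℝ)) * ‖p.2.2‖ ^ (-(2 : ℝ)) *
          ‖p.1 - p.2.1‖ ^ (-(2 : ℝ)) * ‖p.2.1 - p.2.2‖ ^ (-(2 : ℝ)) *
          ‖p.1 - p.2.2‖ ^ (-(2 : ℝ)) * fderiv ℝ (⇑φ) p p) ∧
    (∫ p : EuclideanSpace ℝ (Fin 4) × EuclideanSpace ℝ (Fin 4) ×
        EuclideanSpace ℝ (Fin 4),
        ‖p.1‖ ^ (-(2 : ℝ)) * ‖p.2.1‖ ^ (-(2 : ℝ)) * ‖p.2.2‖ ^ (-(2 : ℝ)) *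
          ‖p.1 - p.2.1‖ ^ (-(2 : ℝ)) * ‖p.2.1 - p.2.2‖ ^ (-(2 : ℝ)) *
          ‖p.1 - p.2.2‖ ^ (-(2 : ℝ)) * fderiv ℝ (⇑φ) p p)
      = -12 * Real.pi ^ 6 * zeta3 * φ 0 := by
  exact main_aux φ

end
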